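/- Let {B_{k|0}} and {B_{k|1}} be Fourier families on ℂ^n, set B̂_d(α) = ∑_{k=1}^{d-1} ( Z_d^k ⊗ B_{k|0} + γ(α)·X_d^k ⊗ B_{k|1} + δ_k(α)·Z_d^k ⊗ 𝟙_n ) and S(α) = ∑_{k=1}^{d-1} ( γ(α)·X_d^k ⊗ B_{k|1} + δ_k(α)·Z_d^k ⊗ 𝟙_n ). If a unit vector ψ ∈ ℂ^d ⊗ ℂ^n satisfies Re⟨ψ, B̂_d(α) ψ⟩ = d (i.e. the maximal quantum value is attained), then (Z_d^k ⊗ B_{k|0}) ψ = ψ for every k = 1,…,d−1, and S(α) ψ = ψ. -/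

import Mathlib

open Matrix Kronecker Finset
open scoped ComplexOrder

noncomputable section

/-- `ω = exp(2πi/d)`. -/
def om (d : ℕ) : ℂ := Complex.exp (2 * Real.pi * Complex.I / d)

/-- The generalized Pauli matrix `Z_d = ∑_i ω^i |i⟩⟨i|`. -/
def Zd (d : ℕ) : Matrix (Fin d) (Fin d) ℂ :=
  Matrix.diagonal fun i => om d ^ (i : ℕ)

/-- The generalized Pauli matrix `X_d = ∑_i |i+1 mod d⟩⟨i|`. -/
def Xd (d : ℕ) : Matrix (Fin d) (Fin d) ℂ :=
  Matrix.of fun i j => if (i : ℕ) = ((j : ℕ) + 1) % d then 1 else 0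

/-- `γ(α) = d / ∑_{i≠j} α_i/α_j` (sum over ordered pairs `i ≠ j`). -/
def gam (d : ℕ) (α : Fin d → ℝ) : ℝ :=
  d / ∑ i : Fin d, ∑ j : Fin d, if i ≠ j then α i / α j else 0

/-- `δ_k(α) = -(γ(α)/d) ∑_{i≠j} (α_i/α_j) ω^{k(d-j)}`. -/
def delt (d : ℕ) (α : Fin d → ℝ) (k : ℕ) : ℂ :=
  -(((gam d α : ℝ) : ℂ) / d) * ∑ i : Fin d, ∑ j : Fin d,
    if i ≠ j then ((α i / α j : ℝ) : ℂ) * om d ^ (k * (d - (j : ℕ))) else 0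

/-- A Fourier family on `ℂ^n`: `B 0 = 1`, `Bₖ†Bₖ ≤ 𝟙`, and `B_{d-k} = Bₖ†` (the latter stated
via negation in `Fin d`). -/
def IsFourierFamily (d n : ℕ) (B : Fin d → Matrix (Fin n) (Fin n) ℂ) : Prop :=
  (∀ k : Fin d, (k : ℕ) = 0 → B k = 1) ∧
  (∀ k : Fin d, ((1 : Matrix (Fin n) (Fin n) ℂ) - (B k)ᴴ * B k).PosSemidef) ∧
  (∀ k : Fin d, B (-k) = (B k)ᴴ)

/-- The operator `S(α) = ∑_{k=1}^{d-1} (γ(α)·X_d^k ⊗ B_k + δ_k(α)·Z_d^k ⊗ 𝟙_n)`. -/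
def sOp (d n : ℕ) (α : Fin d → ℝ) (B : Fin d → Matrix (Fin n) (Fin n) ℂ) :
    Matrix (Fin d × Fin n) (Fin d × Fin n) ℂ :=
  ∑ k ∈ Finset.univ.filter (fun k : Fin d => (k : ℕ) ≠ 0),
    (((gam d α : ℝ) : ℂ) • ((Xd d ^ (k : ℕ)) ⊗ₖ B k)
      + delt d α (k : ℕ) • ((Zd d ^ (k : ℕ)) ⊗ₖ (1 : Matrix (Fin n) (Fin n) ℂ)))

/-- The steering operator
`B̂_d(α) = ∑_{k=1}^{d-1} (Z_d^k ⊗ B_{k|0} + γ(α)·X_d^k ⊗ B_{k|1} + δ_k(α)·Z_d^k ⊗ 𝟙_n)`. -/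
def steerOp (d n : ℕ) (α : Fin d → ℝ) (B0 B1 : Fin d → Matrix (Fin n) (Fin n) ℂ) :
    Matrix (Fin d × Fin n) (Fin d × Fin n) ℂ :=
  ∑ k ∈ Finset.univ.filter (fun k : Fin d => (k : ℕ) ≠ 0),
    ((Zd d ^ (k : ℕ)) ⊗ₖ B0 k
      + ((gam d α : ℝ) : ℂ) • ((Xd d ^ (k : ℕ)) ⊗ₖ B1 k)
      + delt d α (k : ℕ) • ((Zd d ^ (k : ℕ)) ⊗ₖ (1 : Matrix (Fin n) (Fin n) ℂ)))



lemma om_prim (d : ℕ) [NeZero d] : IsPrimitiveRoot (om d) d :=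
  Complex.isPrimitiveRoot_exp d (NeZero.ne d)

lemma Zpow (d : ℕ) (k : ℕ) : Zd d ^ k = Matrix.diagonal fun i : Fin d => om d ^ ((i : ℕ) * k) := by
  rw [Zd, Matrix.diagonal_pow]
  congr 1
  funext i
  simp [pow_mul]

lemma Xpow_aux (d : ℕ) [NeZero d] (k : ℕ) (i j : Fin d) :
    (Xd d ^ k) i j = if (i : ℕ) = ((j : ℕ) + k) % d then 1 else 0 := by
  induction k generalizing i j with
  | zero =>
    simp only [pow_zero, Matrix.one_apply, add_zero, Nat.mod_eq_of_lt j.2, Fin.ext_iff]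
  | succ k ih =>
    rw [pow_succ, Matrix.mul_apply]
    rw [Finset.sum_eq_single (⟨((j : ℕ) + 1) % d, Nat.mod_lt _ (NeZero.pos d)⟩ : Fin d)]
    · rw [ih]
      simp only [Xd, Matrix.of_apply, if_true, mul_one, Nat.mod_add_mod]
      rw [show (j : ℕ) + 1 + k = j + (k + 1) by ring]
    · intro b _ hb
      have : ¬ ((b : ℕ) = ((j : ℕ) + 1) % d) := fun h => hb (Fin.ext h)
      simp [Xd, this]
    · simp

lemma Xpow (d : ℕ) [NeZero d] (k i j : Fin d) :
    (Xd d ^ (k : ℕ)) i j = if j = i - k then 1 else 0 := by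
  rw [Xpow_aux]
  congr 1
  rw [eq_sub_iff_add_eq, eq_comm (a := j + k), Fin.ext_iff, Fin.val_add]

/-- squared norm -/
def NN {m : Type} [Fintype m] (v : m → ℂ) : ℝ := ∑ a, Complex.normSq (v a)

def blk {d n : ℕ} (ψ : Fin d × Fin n → ℂ) (i : Fin d) : Fin n → ℂ := fun a => ψ (i, a)

lemma NN_eq {m : Type} [Fintype m] (v : m → ℂ) : star v ⬝ᵥ v = (NN v : ℂ) := by
  simp only [NN, dotProduct, Complex.ofReal_sum, Complex.normSq_eq_conj_mul_self]
  rfl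

lemma NN_nonneg {m : Type} [Fintype m] (v : m → ℂ) : 0 ≤ NN v :=
  Finset.sum_nonneg fun _ _ => Complex.normSq_nonneg _

lemma NN_zero {m : Type} [Fintype m] {v : m → ℂ} (h : NN v = 0) : v = 0 := by
  funext a
  have := (Finset.sum_eq_zero_iff_of_nonneg (fun a _ => Complex.normSq_nonneg (v a))).1 h a
    (Finset.mem_univ a)
  simpa using this

lemma NN_contr {n : ℕ} (B : Matrix (Fin n) (Fin n) ℂ)
    (h : ((1 : Matrix (Fin n) (Fin n) ℂ) - Bᴴ * B).PosSemidef) (v : Fin n → ℂ) :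
    NN (B *ᵥ v) ≤ NN v := by
  have h1 := h.dotProduct_mulVec_nonneg v
  rw [Matrix.sub_mulVec, dotProduct_sub, Matrix.one_mulVec, NN_eq, ← Matrix.mulVec_mulVec,
    Matrix.dotProduct_mulVec, ← Matrix.star_mulVec, NN_eq, ← Complex.ofReal_sub] at h1
  have := Complex.zero_le_real.1 h1
  linarith

lemma NN_expand {m : Type} [Fintype m] (u w : m → ℂ) (t : ℝ) :
    NN ((t : ℂ) • u - w) = t ^ 2 * NN u + NN w - 2 * t * (star u ⬝ᵥ w).re := by
  simp only [NN, dotProduct, Complex.re_sum, Finset.mul_sum, ← Finset.sum_add_distrib,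
    ← Finset.sum_sub_distrib]
  refine Finset.sum_congr rfl fun a _ => ?_
  simp [Complex.normSq_apply]
  ring

lemma key {m : Type} [Fintype m] (u w : m → ℂ) (x t : ℝ) (ht : 0 < t) (hw : NN w ≤ x) :
    0 ≤ (t * NN u + t⁻¹ * x) / 2 - (star u ⬝ᵥ w).re ∧
    ((t * NN u + t⁻¹ * x) / 2 - (star u ⬝ᵥ w).re = 0 → w = (t : ℂ) • u) := by
  have h := NN_expand u w t
  have h0 := NN_nonneg ((t : ℂ) • u - w)
  have e : (t * NN u + t⁻¹ * x) / 2 - (star u ⬝ᵥ w).re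
      = (2 * t)⁻¹ * (NN ((t : ℂ) • u - w) + (x - NN w)) := by
    rw [h]; field_simp; ring
  rw [e]
  refine ⟨mul_nonneg (by positivity) (by linarith), fun h2 => ?_⟩
  have h3 : NN ((t : ℂ) • u - w) + (x - NN w) = 0 := by
    rcases mul_eq_zero.1 h2 with h4 | h4
    · exact absurd h4 (by positivity)
    · exact h4
  have := NN_zero (v := (t : ℂ) • u - w) (by linarith)
  exact (sub_eq_zero.1 this).symm

lemma blk_Z {d n : ℕ} (k : ℕ) (B : Matrix (Fin n) (Fin n) ℂ) (ψ : Fin d × Fin n → ℂ) (i : Fin d) :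
    blk (((Zd d ^ k) ⊗ₖ B) *ᵥ ψ) i = om d ^ ((i : ℕ) * k) • (B *ᵥ blk ψ i) := by
  funext a
  simp only [blk, Matrix.mulVec, dotProduct, Fintype.sum_prod_type, kroneckerMap_apply, Zpow,
    Matrix.diagonal_apply, Pi.smul_apply, smul_eq_mul]
  rw [Finset.sum_eq_single i]
  · simp [Finset.mul_sum, mul_assoc]
  · intro b _ hb
    simp [hb.symm]
  · simp

lemma blk_X {d n : ℕ} [NeZero d] (k : Fin d) (B : Matrix (Fin n) (Fin n) ℂ)
    (ψ : Fin d × Fin n → ℂ) (i : Fin d) :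
    blk (((Xd d ^ (k : ℕ)) ⊗ₖ B) *ᵥ ψ) i = B *ᵥ blk ψ (i - k) := by
  funext a
  simp only [blk, Matrix.mulVec, dotProduct, Fintype.sum_prod_type, kroneckerMap_apply, Xpow]
  rw [Finset.sum_eq_single (i - k)]
  · simp
  · intro b _ hb
    simp [hb]
  · simp

lemma dot_blk {d n : ℕ} (ψ φ : Fin d × Fin n → ℂ) :
    star ψ ⬝ᵥ φ = ∑ i, star (blk ψ i) ⬝ᵥ blk φ i := by
  simp [dotProduct, Fintype.sum_prod_type, blk]

lemma NN_blk {d n : ℕ} (ψ : Fin d × Fin n → ℂ) : NN ψ = ∑ i, NN (blk ψ i) := by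
  simp [NN, Fintype.sum_prod_type, blk]

lemma NN_smul_om {d n : ℕ} (e : ℕ) (v : Fin n → ℂ) : NN (om d ^ e • v) = NN v := by
  have h : Complex.normSq (om d) = 1 := by
    rw [Complex.normSq_eq_norm_sq, om,
      show (2 * Real.pi * Complex.I / d : ℂ) = ((2 * Real.pi / d : ℝ) : ℂ) * Complex.I by
        push_cast; ring, Complex.norm_exp_ofReal_mul_I]
    norm_num
  simp [NN, map_mul, map_pow, h]

lemma root_sum (d : ℕ) [NeZero d] (i j : Fin d) :
    ∑ k : Fin d, om d ^ ((k : ℕ) * (d - (j : ℕ))) * om d ^ ((i : ℕ) * (k : ℕ))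
      = if i = j then (d : ℂ) else 0 := by
  have hp := om_prim d
  have e : ∀ k : Fin d, om d ^ ((k : ℕ) * (d - (j : ℕ))) * om d ^ ((i : ℕ) * (k : ℕ))
      = (om d ^ (d - (j : ℕ) + i)) ^ (k : ℕ) := by
    intro k; rw [← pow_add, ← pow_mul]; congr 1; ring
  simp only [e]
  rw [Fin.sum_univ_eq_sum_range (fun k => (om d ^ (d - (j : ℕ) + i)) ^ k) d]
  have hi := i.2
  have hj := j.2
  split_ifs with h
  · subst h
    rw [Nat.sub_add_cancel hi.le, hp.pow_eq_one]; simp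
  · have hne : om d ^ (d - (j : ℕ) + i) ≠ 1 := by
      intro h1
      obtain ⟨c, hc⟩ := (hp.pow_eq_one_iff_dvd _).1 h1
      apply h
      apply Fin.ext
      have : c = 1 := by
        have h2 : c < 2 := by
          by_contra hh
          have : d * 2 ≤ d * c := Nat.mul_le_mul_left _ (by omega)
          omega
        have h3 : c ≠ 0 := by rintro rfl; omega
        omega
      subst this
      omega
    rw [geom_sum_eq hne, ← pow_mul, mul_comm, pow_mul, hp.pow_eq_one]; simp

lemma filt_sum {M : Type} [AddCommGroup M] (d : ℕ) [NeZero d] (f : Fin d → M) :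
    ∑ k ∈ Finset.univ.filter (fun k : Fin d => (k : ℕ) ≠ 0), f k = ∑ k, f k - f 0 := by
  rw [eq_sub_iff_add_eq]
  have : Finset.univ.filter (fun k : Fin d => (k : ℕ) ≠ 0) = Finset.univ.erase 0 := by
    ext k; simp [Fin.val_eq_zero_iff]
  rw [this, Finset.sum_erase_add _ _ (Finset.mem_univ _)]

lemma S_pos (d : ℕ) [NeZero d] (hd : 2 ≤ d) (α : Fin d → ℝ) (hpos : ∀ i, 0 < α i) :
    0 < ∑ i : Fin d, ∑ j : Fin d, if i ≠ j then α i / α j else 0 := by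
  have hnn : ∀ i j : Fin d, 0 ≤ if i ≠ j then α i / α j else 0 := by
    intro i j
    have := hpos i
    have := hpos j
    split_ifs <;> positivity
  refine Finset.sum_pos' (fun i _ => Finset.sum_nonneg fun j _ => hnn i j)
    ⟨⟨0, by omega⟩, Finset.mem_univ _, ?_⟩
  refine Finset.sum_pos' (fun j _ => hnn _ j) ⟨⟨1, by omega⟩, Finset.mem_univ _, ?_⟩
  rw [if_pos (by simp)]
  exact div_pos (hpos _) (hpos _)

lemma delt_sum (d : ℕ) [NeZero d] (hd : 2 ≤ d) (α : Fin d → ℝ) (hpos : ∀ i, 0 < α i) (m : Fin d) :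
    ∑ k ∈ Finset.univ.filter (fun k : Fin d => (k : ℕ) ≠ 0),
        delt d α (k : ℕ) * om d ^ ((m : ℕ) * (k : ℕ))
      = ((1 - gam d α * ∑ k ∈ Finset.univ.filter (fun k : Fin d => (k : ℕ) ≠ 0),
          α (m - k) / α m : ℝ) : ℂ) := by
  have hS := S_pos d hd α hpos
  have hd0 : (d : ℂ) ≠ 0 := by exact_mod_cast NeZero.ne d
  have hg : gam d α * (∑ i : Fin d, ∑ j : Fin d, if i ≠ j then α i / α j else 0) = d := by
    rw [gam, div_mul_cancel₀ _ hS.ne']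
  have h1 : ∑ k ∈ Finset.univ.filter (fun k : Fin d => (k : ℕ) ≠ 0), α (m - k) / α m
      = ∑ i, if i ≠ m then α i / α m else 0 := by
    rw [filt_sum, ← Equiv.sum_comp (Equiv.subLeft m) (fun i => if i ≠ m then α i / α m else 0),
      sub_eq_iff_eq_add, ← Finset.sum_erase_add _ _ (Finset.mem_univ (0 : Fin d)),
      ← Finset.sum_erase_add (a := (0 : Fin d)) _ (fun i => if (Equiv.subLeft m) i ≠ m then α ((Equiv.subLeft m) i) / α m else 0) (Finset.mem_univ (0 : Fin d))]
    simp only [Equiv.subLeft_apply, sub_zero, ne_eq, not_true, if_false, add_zero]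
    congr 1
    refine Finset.sum_congr rfl fun k hk => ?_
    rw [if_pos]
    simpa using hk
  have h2 : ∀ k : Fin d, delt d α (k : ℕ) * om d ^ ((m : ℕ) * (k : ℕ)) =
      -(((gam d α : ℝ) : ℂ) / d) * ∑ i : Fin d, ∑ j : Fin d,
        (((if i ≠ j then α i / α j else 0 : ℝ)) : ℂ) *
          (om d ^ ((k : ℕ) * (d - (j : ℕ))) * om d ^ ((m : ℕ) * (k : ℕ))) := by
    intro k
    rw [delt, mul_assoc, Finset.sum_mul]
    congr 1
    refine Finset.sum_congr rfl fun i _ => ?_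
    rw [Finset.sum_mul]
    refine Finset.sum_congr rfl fun j _ => ?_
    split_ifs <;> simp [mul_assoc]
  simp only [h2]
  rw [← Finset.mul_sum, Finset.sum_comm]
  have h3 : ∀ i : Fin d, ∑ k ∈ Finset.univ.filter (fun k : Fin d => (k : ℕ) ≠ 0), ∑ j : Fin d,
        (((if i ≠ j then α i / α j else 0 : ℝ)) : ℂ) *
          (om d ^ ((k : ℕ) * (d - (j : ℕ))) * om d ^ ((m : ℕ) * (k : ℕ)))
      = ∑ j : Fin d, (((if i ≠ j then α i / α j else 0 : ℝ)) : ℂ) *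
          ((if m = j then (d : ℂ) else 0) - 1) := by
    intro i
    rw [Finset.sum_comm]
    refine Finset.sum_congr rfl fun j _ => ?_
    rw [← Finset.mul_sum, filt_sum, root_sum]
    simp
  simp only [h3, h1, mul_sub, mul_one, Finset.sum_sub_distrib]
  have h4 : ∀ i : Fin d, ∑ j : Fin d, (((if i ≠ j then α i / α j else 0 : ℝ)) : ℂ) *
          (if m = j then (d : ℂ) else 0) = (((if i ≠ m then α i / α m else 0 : ℝ)) : ℂ) * d := by
    intro i
    simp only [mul_ite, mul_zero]
    rw [Finset.sum_ite_eq]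
    simp
  simp only [h4]
  simp only [← Complex.ofReal_sum]
  rw [← Finset.sum_mul, ← Complex.ofReal_sum]
  set T := ∑ i : Fin d, ∑ j : Fin d, if i ≠ j then α i / α j else 0
  have hgc : ((gam d α : ℝ) : ℂ) * (T : ℂ) = d := by exact_mod_cast hg
  push_cast
  field_simp
  linear_combination hgc

lemma blk_s {d n : ℕ} [NeZero d] (hd : 2 ≤ d) (α : Fin d → ℝ) (hpos : ∀ i, 0 < α i)
    (B : Fin d → Matrix (Fin n) (Fin n) ℂ) (ψ : Fin d × Fin n → ℂ) (i : Fin d) :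
    blk (sOp d n α B *ᵥ ψ) i =
      ((gam d α : ℝ) : ℂ) • (∑ k ∈ Finset.univ.filter (fun k : Fin d => (k : ℕ) ≠ 0),
        B k *ᵥ blk ψ (i - k))
      + ((1 - gam d α * ∑ k ∈ Finset.univ.filter (fun k : Fin d => (k : ℕ) ≠ 0),
          α (i - k) / α i : ℝ) : ℂ) • blk ψ i := by
  rw [← delt_sum d hd α hpos i, Finset.smul_sum, Finset.sum_smul, ← Finset.sum_add_distrib, sOp,
    Matrix.sum_mulVec]
  have : ∀ (s : Finset (Fin d)) (f : Fin d → (Fin d × Fin n → ℂ)),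
      blk (∑ k ∈ s, f k) i = ∑ k ∈ s, blk (f k) i := by
    intro s f; funext a; simp [blk]
  rw [this]
  refine Finset.sum_congr rfl fun k _ => ?_
  have hadd : ∀ f g : Fin d × Fin n → ℂ, blk (f + g) i = blk f i + blk g i := fun _ _ => rfl
  have hsm : ∀ (c : ℂ) (f : Fin d × Fin n → ℂ), blk (c • f) i = c • blk f i := fun _ _ => rfl
  rw [Matrix.add_mulVec, hadd, Matrix.smul_mulVec, Matrix.smul_mulVec, hsm, hsm, blk_X,
    blk_Z, Matrix.one_mulVec, smul_smul]

/-- if a unit vector attains the maximal quantum value `d` of the steering operator,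
then it is a fixed point of each `Z_d^k ⊗ B_{k|0}` (k = 1,…,d−1) and of `S(α)`. -/
theorem max_violation_fixed_points (d n : ℕ) [NeZero d] (hd : 2 ≤ d)
    (α : Fin d → ℝ) (hpos : ∀ i, 0 < α i) (hnorm : ∑ i, α i ^ 2 = 1)
    (B0 B1 : Fin d → Matrix (Fin n) (Fin n) ℂ)
    (hB0 : IsFourierFamily d n B0) (hB1 : IsFourierFamily d n B1)
    (ψ : Fin d × Fin n → ℂ) (hψ : ∑ p, Complex.normSq (ψ p) = 1)
    (hmax : (star ψ ⬝ᵥ (steerOp d n α B0 B1).mulVec ψ).re = d) :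
    (∀ k : Fin d, (k : ℕ) ≠ 0 → ((Zd d ^ (k : ℕ)) ⊗ₖ B0 k).mulVec ψ = ψ)
    ∧ (sOp d n α B1).mulVec ψ = ψ := by
  set F := Finset.univ.filter (fun k : Fin d => (k : ℕ) ≠ 0) with hF
  have hγ : 0 < gam d α := div_pos (by exact_mod_cast NeZero.pos d) (S_pos d hd α hpos)
  have hN : ∑ i, NN (blk ψ i) = 1 := by rw [← NN_blk]; exact hψ
  have hsplit : steerOp d n α B0 B1 = ∑ k ∈ F, (Zd d ^ (k : ℕ)) ⊗ₖ B0 k + sOp d n α B1 := by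
    rw [sOp, ← Finset.sum_add_distrib, steerOp]
    exact Finset.sum_congr rfl fun k _ => add_assoc _ _ _
  -- slacks
  set R0 : Fin d → Fin d → ℝ := fun k i =>
    (star (blk ψ i) ⬝ᵥ (om d ^ ((i : ℕ) * k) • (B0 k *ᵥ blk ψ i))).re with hR0
  set R1 : Fin d → Fin d → ℝ := fun k i =>
    (star (blk ψ i) ⬝ᵥ (B1 k *ᵥ blk ψ (i - k))).re with hR1
  have k0 := fun k i => key (blk ψ i) (om d ^ ((i : ℕ) * (k : Fin d)) • (B0 k *ᵥ blk ψ i))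
    (NN (blk ψ i)) 1 one_pos (by rw [NN_smul_om]; exact NN_contr _ (hB0.2.1 k) _)
  have k1 := fun k i => key (blk ψ i) (B1 k *ᵥ blk ψ (i - k))
    (NN (blk ψ (i - k))) (α (i - k) / α i) (div_pos (hpos _) (hpos _))
      (NN_contr _ (hB1.2.1 k) _)
  have v0 : (star ψ ⬝ᵥ ((∑ k ∈ F, (Zd d ^ (k : ℕ)) ⊗ₖ B0 k) *ᵥ ψ)).re
      = ∑ k ∈ F, ∑ i, R0 k i := by
    rw [Matrix.sum_mulVec, dotProduct_sum, Complex.re_sum]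
    refine Finset.sum_congr rfl fun k _ => ?_
    rw [dot_blk, Complex.re_sum]
    refine Finset.sum_congr rfl fun i _ => ?_
    rw [blk_Z]
  have v1 : (star ψ ⬝ᵥ (sOp d n α B1 *ᵥ ψ)).re
      = gam d α * ∑ k ∈ F, ∑ i, R1 k i
        + ∑ i, (1 - gam d α * ∑ k ∈ F, α (i - k) / α i) * NN (blk ψ i) := by
    rw [dot_blk, Complex.re_sum, Finset.sum_comm, Finset.mul_sum, ← Finset.sum_add_distrib]
    refine Finset.sum_congr rfl fun i _ => ?_
    rw [blk_s hd α hpos, dotProduct_add, dotProduct_smul, dotProduct_smul, NN_eq, Complex.add_re,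
      dotProduct_sum, smul_eq_mul, smul_eq_mul, Complex.re_ofReal_mul, Complex.re_ofReal_mul,
      Complex.re_sum, Complex.ofReal_re]
  have e0 : ∑ k ∈ F, ∑ i, ((1 * NN (blk ψ i) + 1⁻¹ * NN (blk ψ i)) / 2 - R0 k i)
      = (d - 1) - ∑ k ∈ F, ∑ i, R0 k i := by
    simp only [Finset.sum_sub_distrib]
    congr 1
    have : ∀ i, (1 * NN (blk ψ i) + 1⁻¹ * NN (blk ψ i)) / 2 = NN (blk ψ i) := by
      intro i; ring
    simp only [this, hN]
    rw [hF, filt_sum]; simp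
  have e1 : ∑ k ∈ F, ∑ i, ((α (i - k) / α i * NN (blk ψ i)
        + (α (i - k) / α i)⁻¹ * NN (blk ψ (i - k))) / 2 - R1 k i)
      = ∑ i, (∑ k ∈ F, α (i - k) / α i) * NN (blk ψ i) - ∑ k ∈ F, ∑ i, R1 k i := by
    simp only [Finset.sum_sub_distrib]
    congr 1
    have a1 : ∑ i, (∑ k ∈ F, α (i - k) / α i) * NN (blk ψ i)
        = ∑ k ∈ F, ∑ i, α (i - k) / α i * NN (blk ψ i) := by
      simp only [Finset.sum_mul]
      rw [Finset.sum_comm]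
    have a2 : ∑ k ∈ F, ∑ i, (α (i - k) / α i)⁻¹ * NN (blk ψ (i - k))
        = ∑ k ∈ F, ∑ i, α (i - k) / α i * NN (blk ψ i) := by
      refine Finset.sum_bij' (fun k _ => -k) (fun k _ => -k) ?_ ?_ ?_ ?_ ?_
      · intro k hk; simpa [hF, Fin.val_eq_zero_iff] using hk
      · intro k hk; simpa [hF, Fin.val_eq_zero_iff] using hk
      · simp
      · simp
      · intro k _
        rw [← Equiv.sum_comp (Equiv.subRight k) (fun i => α (i - -k) / α i * NN (blk ψ i))]
        simp
    rw [a1]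
    simp only [← Finset.sum_div, Finset.sum_add_distrib]
    rw [a2]; ring
  rw [hsplit, Matrix.add_mulVec, dotProduct_add, Complex.add_re, v0, v1] at hmax
  have e2 : ∑ i, (1 - gam d α * ∑ k ∈ F, α (i - k) / α i) * NN (blk ψ i)
      = 1 - gam d α * ∑ i, (∑ k ∈ F, α (i - k) / α i) * NN (blk ψ i) := by
    simp only [sub_mul, one_mul, Finset.sum_sub_distrib, hN, mul_assoc]
    rw [← Finset.mul_sum]
  rw [e2] at hmax
  have n0 := Finset.sum_nonneg fun k (_ : k ∈ F) => Finset.sum_nonneg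
    fun i (_ : i ∈ Finset.univ) => (k0 k i).1
  have n1 := Finset.sum_nonneg fun k (_ : k ∈ F) => Finset.sum_nonneg
    fun i (_ : i ∈ Finset.univ) => (k1 k i).1
  have n1' := mul_nonneg hγ.le n1
  have z0 : ∑ k ∈ F, ∑ i, ((1 * NN (blk ψ i) + 1⁻¹ * NN (blk ψ i)) / 2 - R0 k i) = 0 := by
    refine le_antisymm ?_ n0
    rw [e1, mul_sub] at n1'
    rw [e0]; linarith
  have z1 : ∑ k ∈ F, ∑ i, ((α (i - k) / α i * NN (blk ψ i)
        + (α (i - k) / α i)⁻¹ * NN (blk ψ (i - k))) / 2 - R1 k i) = 0 := by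
    have : gam d α * ∑ k ∈ F, ∑ i, ((α (i - k) / α i * NN (blk ψ i)
        + (α (i - k) / α i)⁻¹ * NN (blk ψ (i - k))) / 2 - R1 k i) = 0 := by
      rw [e1, mul_sub]
      rw [e0] at z0
      linarith
    exact (mul_eq_zero.1 this).resolve_left hγ.ne'
  have f0 : ∀ k ∈ F, ∀ i : Fin d, om d ^ ((i : ℕ) * k) • (B0 k *ᵥ blk ψ i) = blk ψ i := by
    intro k hk i
    have h := (Finset.sum_eq_zero_iff_of_nonneg (fun k _ => Finset.sum_nonneg
      fun i _ => (k0 k i).1)).1 z0 k hk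
    have h := (Finset.sum_eq_zero_iff_of_nonneg (fun i _ => (k0 k i).1)).1 h i (Finset.mem_univ _)
    simpa using (k0 k i).2 h
  have f1 : ∀ k ∈ F, ∀ i, B1 k *ᵥ blk ψ (i - k) = ((α (i - k) / α i : ℝ) : ℂ) • blk ψ i := by
    intro k hk i
    have h := (Finset.sum_eq_zero_iff_of_nonneg (fun k _ => Finset.sum_nonneg
      fun i _ => (k1 k i).1)).1 z1 k hk
    have h := (Finset.sum_eq_zero_iff_of_nonneg (fun i _ => (k1 k i).1)).1 h i (Finset.mem_univ _)
    exact (k1 k i).2 h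
  have bext : ∀ φ : Fin d × Fin n → ℂ, (∀ i, blk φ i = blk ψ i) → φ = ψ := by
    intro φ h
    funext ⟨i, a⟩
    exact congrFun (h i) a
  refine ⟨fun k hk => bext _ fun i => ?_, bext _ fun i => ?_⟩
  · rw [blk_Z]
    exact f0 k (Finset.mem_filter.2 ⟨Finset.mem_univ _, hk⟩) i
  · rw [blk_s hd α hpos, Finset.sum_congr rfl fun k hk => f1 k hk i, ← Finset.sum_smul, smul_smul,
      ← add_smul, ← Complex.ofReal_sum, ← Complex.ofReal_mul, ← Complex.ofReal_add,
      add_sub_cancel, Complex.ofReal_one, one_smul]
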